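/- A graph G is (2P_3,C_4,C_6,C_7)-free, contains an induced T_0, and contains no simplicial vertices if and only if G can be obtained from a thickening of T_0 or of T_1 by possibly adding universal vertices to it. -/

import Mathlib

open SimpleGraph

namespace Paper2P3

variable {V : Type*}

/-- `G` contains an induced subgraph isomorphic to `H`. -/
def ContainsInduced {V W : Type*} (G : SimpleGraph V) (H : SimpleGraph W) : Prop :=
  ∃ s : Set V, Nonempty (H ≃g G.induce s)

/-- `G` is `H`-free: no induced subgraph of `G` is isomorphic to `H`. -/
def HFree {V W : Type*} (G : SimpleGraph V) (H : SimpleGraph W) : Prop :=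
  ¬ ContainsInduced G H

/-- `S` is complete to `T` in `G`. -/
def Complete (G : SimpleGraph V) (S T : Set V) : Prop :=
  ∀ a ∈ S, ∀ b ∈ T, G.Adj a b

/-- `S` is anticomplete to `T` in `G`. -/
def Anticomplete (G : SimpleGraph V) (S T : Set V) : Prop :=
  ∀ a ∈ S, ∀ b ∈ T, ¬ G.Adj a b

/-- The closed neighborhood `N_G[v]`. -/
def closedNbhd (G : SimpleGraph V) (v : V) : Set V := insert v (G.neighborSet v)

/-- A simplicial vertex: its neighborhood is a clique. -/
def IsSimplicial (G : SimpleGraph V) (v : V) : Prop := G.IsClique (G.neighborSet v)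

/-- A universal vertex: adjacent to all other vertices. -/
def IsUniversalVertex (G : SimpleGraph V) (v : V) : Prop := ∀ w, w ≠ v → G.Adj v w

/-- `G` admits a clique-cutset: a clique `C ⊊ V(G)` such that `G - C` is disconnected. -/
def HasCliqueCutset (G : SimpleGraph V) : Prop :=
  ∃ C : Set V, G.IsClique C ∧ C ≠ Set.univ ∧ ¬ (G.induce Cᶜ).Connected

/-- The disjoint union of two copies of `P_3`, on vertices `0,1,2` and `3,4,5`. -/
def twoP3 : SimpleGraph (Fin 6) :=
  SimpleGraph.fromRel fun a b => (a, b) ∈ ([(0,1),(1,2),(3,4),(4,5)] : List (Fin 6 × Fin 6))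

/-- The edgeless graph on four vertices. -/
def fourK1 : SimpleGraph (Fin 4) := ⊥

/-- `Gs` is a thickening of `G`. -/
def IsThickening {α β : Type*} (Gs : SimpleGraph β) (G : SimpleGraph α) : Prop :=
  ∃ X : α → Set β,
    (∀ v, (X v).Nonempty) ∧
    (∀ u v : α, u ≠ v → Disjoint (X u) (X v)) ∧
    (⋃ v, X v) = Set.univ ∧
    (∀ v, Gs.IsClique (X v)) ∧
    (∀ u v : α, u ≠ v →
      (G.Adj u v → Complete Gs (X u) (X v)) ∧ (¬ G.Adj u v → Anticomplete Gs (X u) (X v)))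

/-- The closed neighborhoods of the vertices of `S` form a chain under inclusion;
equivalently (for finite graphs), `S` can be ordered as `a_1, …, a_r` with
`N_G[a_r] ⊆ ⋯ ⊆ N_G[a_1]`. -/
def ChainClosedNbhd (G : SimpleGraph V) (S : Set V) : Prop :=
  ∀ a ∈ S, ∀ b ∈ S, closedNbhd G a ⊆ closedNbhd G b ∨ closedNbhd G b ⊆ closedNbhd G a

/-- `A` can be partitioned into cliques, pairwise anticomplete to each other. -/
def CliquesPartition (G : SimpleGraph V) (A : Set V) : Prop :=
  ∃ (ℓ : ℕ) (P : Fin ℓ → Set V),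
    (∀ i, G.IsClique (P i)) ∧
    (∀ i j, i ≠ j → Disjoint (P i) (P j)) ∧
    (∀ i j, i ≠ j → Anticomplete G (P i) (P j)) ∧
    (⋃ i, P i) = A

/-- `A` can be partitioned into nonempty cliques, pairwise anticomplete to each other. -/
def NonemptyCliquesPartition (G : SimpleGraph V) (A : Set V) : Prop :=
  ∃ (ℓ : ℕ) (P : Fin ℓ → Set V),
    (∀ i, (P i).Nonempty) ∧
    (∀ i, G.IsClique (P i)) ∧
    (∀ i j, i ≠ j → Disjoint (P i) (P j)) ∧
    (∀ i j, i ≠ j → Anticomplete G (P i) (P j)) ∧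
    (⋃ i, P i) = A

/-- `A` can be partitioned into nonempty cliques, pairwise anticomplete to each other,
each of which can be ordered so that the closed neighborhoods form a decreasing chain. -/
def OrderedCliquesPartition (G : SimpleGraph V) (A : Set V) : Prop :=
  ∃ (ℓ : ℕ) (P : Fin ℓ → Set V),
    (∀ i, (P i).Nonempty) ∧
    (∀ i, G.IsClique (P i)) ∧
    (∀ i j, i ≠ j → Disjoint (P i) (P j)) ∧
    (∀ i j, i ≠ j → Anticomplete G (P i) (P j)) ∧
    (⋃ i, P i) = A ∧
    (∀ i, ChainClosedNbhd G (P i))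

/-- `(X_0,…,X_6; Y_0,…,Y_6; Z_0,…,Z_6; W)` is a special partition of the induced
subgraph of `G` on `S` (indices in `ℤ_7`). -/
def IsSpecialPartitionOn (G : SimpleGraph V) (S : Set V)
    (X Y Z : ZMod 7 → Set V) (W : Set V) : Prop :=
  -- the sets are pairwise disjoint and their union is `S`
  (∀ i j, i ≠ j → Disjoint (X i) (X j)) ∧
  (∀ i j, i ≠ j → Disjoint (Y i) (Y j)) ∧
  (∀ i j, i ≠ j → Disjoint (Z i) (Z j)) ∧
  (∀ i j, Disjoint (X i) (Y j)) ∧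
  (∀ i j, Disjoint (X i) (Z j)) ∧
  (∀ i j, Disjoint (Y i) (Z j)) ∧
  (∀ i, Disjoint (X i) W) ∧ (∀ i, Disjoint (Y i) W) ∧ (∀ i, Disjoint (Z i) W) ∧
  ((⋃ i, X i) ∪ (⋃ i, Y i) ∪ (⋃ i, Z i) ∪ W = S) ∧
  -- all the sets are cliques
  (∀ i, G.IsClique (X i)) ∧ (∀ i, G.IsClique (Y i)) ∧ (∀ i, G.IsClique (Z i)) ∧
  G.IsClique W ∧
  -- (a)
  (∀ i, (X i).Nonempty) ∧
  -- (b)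
  (∀ i, Complete G (X i) (X (i - 1)) ∧ Complete G (X i) (X (i + 1)) ∧
    Anticomplete G (X i) (X (i + 2)) ∧ Anticomplete G (X i) (X (i + 3)) ∧
    Anticomplete G (X i) (X (i + 4)) ∧ Anticomplete G (X i) (X (i + 5))) ∧
  -- (c)
  (∀ i, Complete G (X i) (Y i) ∧ Complete G (X i) (Y (i + 3)) ∧
    Complete G (X i) (Y (i + 6)) ∧ Complete G (X i) (Z i) ∧
    Complete G (X i) (Z (i + 3)) ∧ Complete G (X i) (Z (i + 4)) ∧
    Complete G (X i) (Z (i + 5)) ∧ Complete G (X i) (Z (i + 6)) ∧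
    Complete G (X i) W ∧
    Anticomplete G (X i) (Y (i + 1)) ∧ Anticomplete G (X i) (Y (i + 2)) ∧
    Anticomplete G (X i) (Y (i + 4)) ∧ Anticomplete G (X i) (Y (i + 5)) ∧
    Anticomplete G (X i) (Z (i + 1)) ∧ Anticomplete G (X i) (Z (i + 2))) ∧
  -- (d)
  (∀ i, (Y i).Nonempty →
    (Y (i + 1) = ∅ ∧ Y (i + 2) = ∅ ∧ Y (i + 5) = ∅ ∧ Y (i + 6) = ∅ ∧
      Z (i + 5) = ∅ ∧ Z (i + 6) = ∅) ∧ (Y (i + 3) = ∅ ∨ Y (i + 4) = ∅)) ∧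
  -- (e)
  (∀ i, (Z i).Nonempty → Z (i + 2) = ∅ ∧ Z (i + 5) = ∅) ∧
  -- (f)
  (∀ i, Complete G (Y i) (Y (i + 3)) ∧ Complete G (Y i) (Y (i + 4)) ∧
    Complete G (Y i) (Z i) ∧ Complete G (Y i) (Z (i + 1)) ∧
    Complete G (Y i) (Z (i + 3)) ∧ Complete G (Y i) (Z (i + 4)) ∧
    Complete G (Y i) W ∧ Anticomplete G (Y i) (Z (i + 2))) ∧
  -- (g)
  (∀ i, Complete G (Z i) (Z (i + 1)) ∧ Complete G (Z i) (Z (i + 3)) ∧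
    Complete G (Z i) (Z (i + 4)) ∧ Complete G (Z i) (Z (i + 6)) ∧ Complete G (Z i) W)

/-- `G` admits a special partition. -/
def AdmitsSpecialPartition (G : SimpleGraph V) : Prop :=
  ∃ (X Y Z : ZMod 7 → Set V) (W : Set V), IsSpecialPartitionOn G Set.univ X Y Z W

/-- `G` is a 7-saucer. -/
def IsSevenSaucer (G : SimpleGraph V) : Prop :=
  ∃ (X Y Z : ZMod 7 → Set V) (W A : Set V),
    IsSpecialPartitionOn G Aᶜ X Y Z W ∧
    (∀ i, Anticomplete G A (X i)) ∧
    (∀ i, Anticomplete G A (Y i) ∨ Z (i + 2) = ∅) ∧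
    (A = ∅ ∨ OrderedCliquesPartition G A)
/-- The graph `M_0`: vertices `0,…,6` are `x_0,…,x_6` (a 7-cycle), `7 = y_0`,
`8 = y_3`, `9 = z_0`, `10 = z_3`, `11 = z_4`. -/
def M0 : SimpleGraph (Fin 12) :=
  SimpleGraph.fromRel fun a b => (a, b) ∈
    ([(0,1),(1,2),(2,3),(3,4),(4,5),(5,6),(6,0),
      (7,0),(7,1),(7,4),
      (8,3),(8,4),(8,0),
      (9,0),(9,1),(9,2),(9,3),(9,4),
      (10,3),(10,4),(10,5),(10,6),(10,0),
      (11,4),(11,5),(11,6),(11,0),(11,1),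
      (7,8),(7,9),(7,10),(7,11),(8,9),(8,10),(8,11),(9,10),(9,11),(10,11)] :
      List (Fin 12 × Fin 12))

/-- The graph `M_1`: vertices `0,…,6` are `x_0,…,x_6` (a 7-cycle), `7 = y_0`, `8 = z_2`. -/
def M1 : SimpleGraph (Fin 9) :=
  SimpleGraph.fromRel fun a b => (a, b) ∈
    ([(0,1),(1,2),(2,3),(3,4),(4,5),(5,6),(6,0),
      (7,0),(7,1),(7,4),
      (8,2),(8,3),(8,4),(8,5),(8,6)] : List (Fin 9 × Fin 9))

/-- The graph `M_2`: `M_1` plus the vertex `9 = z_1`. -/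
def M2 : SimpleGraph (Fin 10) :=
  SimpleGraph.fromRel fun a b => (a, b) ∈
    ([(0,1),(1,2),(2,3),(3,4),(4,5),(5,6),(6,0),
      (7,0),(7,1),(7,4),
      (8,2),(8,3),(8,4),(8,5),(8,6),
      (9,1),(9,2),(9,3),(9,4),(9,5),(9,7),(9,8)] : List (Fin 10 × Fin 10))

/-- The graph `M_3`: `M_1` plus the vertex `9 = z_3`. -/
def M3 : SimpleGraph (Fin 10) :=
  SimpleGraph.fromRel fun a b => (a, b) ∈
    ([(0,1),(1,2),(2,3),(3,4),(4,5),(5,6),(6,0),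
      (7,0),(7,1),(7,4),
      (8,2),(8,3),(8,4),(8,5),(8,6),
      (9,3),(9,4),(9,5),(9,6),(9,0),(9,7),(9,8)] : List (Fin 10 × Fin 10))

/-- The set `{y_0, y_3, z_0, z_3, z_4}` of vertices of `M_0`. -/
def M0Extra : Set (Fin 12) := {7, 8, 9, 10, 11}

/-- `H` is a thickening of a graph in the family `ℳ`, which consists of
`M_1`, `M_2`, `M_3`, and all graphs `M_0 - S` for `S ⊆ {y_0,y_3,z_0,z_3,z_4}`. -/
def IsThickeningOfM {β : Type*} (H : SimpleGraph β) : Prop :=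
  IsThickening H M1 ∨ IsThickening H M2 ∨ IsThickening H M3 ∨
  ∃ S : Set (Fin 12), S ⊆ M0Extra ∧ IsThickening H (M0.induce Sᶜ)
/-- The graph `T_0`: vertices `0 = a_0`, `1 = a_1`, `2 = b_0`, `3 = b_1`, `4 = b_2`,
`5 = b_3`, `6 = c_1`, `7 = c_2`, `8 = c_3`. -/
def T0 : SimpleGraph (Fin 9) :=
  SimpleGraph.fromRel fun a b => (a, b) ∈
    ([(0,1),(0,2),(0,4),(0,5),(1,3),(1,4),(1,5),
      (2,6),(3,6),(4,7),(5,8),(6,7),(6,8),(7,8)] : List (Fin 9 × Fin 9))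

/-- The graph `T_1`: `T_0` plus the vertex `9 = f_3`, adjacent to
`a_0,a_1,b_0,b_1,b_2,c_1,c_2` and nonadjacent to `b_3,c_3`. -/
def T1 : SimpleGraph (Fin 10) :=
  SimpleGraph.fromRel fun a b => (a, b) ∈
    ([(0,1),(0,2),(0,4),(0,5),(1,3),(1,4),(1,5),
      (2,6),(3,6),(4,7),(5,8),(6,7),(6,8),(7,8),
      (9,0),(9,1),(9,2),(9,3),(9,4),(9,6),(9,7)] : List (Fin 10 × Fin 10))
/-- `(A_0,A_1;B_0,B_1,B_2,B_3;C_1,C_2,C_3;F_2,F_3;W;Y;Z)` is a tent partition of `G`. -/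
def IsTentPartition (G : SimpleGraph V)
    (A0 A1 B0 B1 B2 B3 C1 C2 C3 F2 F3 W Y Z : Set V) : Prop :=
  let P : Fin 14 → Set V := ![A0, A1, B0, B1, B2, B3, C1, C2, C3, F2, F3, W, Y, Z]
  -- the fourteen sets form a partition of the vertex set
  (∀ i j : Fin 14, i ≠ j → Disjoint (P i) (P j)) ∧
  (⋃ i, P i) = Set.univ ∧
  -- A_0,A_1,B_0,B_1,B_2,B_3,C_1,C_2,C_3 are nonempty cliques
  (A0.Nonempty ∧ A1.Nonempty ∧ B0.Nonempty ∧ B1.Nonempty ∧ B2.Nonempty ∧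
    B3.Nonempty ∧ C1.Nonempty ∧ C2.Nonempty ∧ C3.Nonempty) ∧
  (G.IsClique A0 ∧ G.IsClique A1 ∧ G.IsClique B0 ∧ G.IsClique B1 ∧ G.IsClique B2 ∧
    G.IsClique B3 ∧ G.IsClique C1 ∧ G.IsClique C2 ∧ G.IsClique C3) ∧
  -- F_2, F_3, Y are cliques, and at most one of them is nonempty
  (G.IsClique F2 ∧ G.IsClique F3 ∧ G.IsClique Y) ∧
  ((F2 = ∅ ∧ F3 = ∅) ∨ (F2 = ∅ ∧ Y = ∅) ∨ (F3 = ∅ ∧ Y = ∅)) ∧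
  -- W is a (possibly empty) clique
  G.IsClique W ∧
  Complete G A0 A1 ∧
  (Complete G A0 B0 ∧ Complete G A0 B2 ∧ Complete G A0 B3 ∧
    Anticomplete G A0 B1 ∧ Anticomplete G A0 C1 ∧ Anticomplete G A0 C2 ∧
    Anticomplete G A0 C3) ∧
  (Complete G A1 B1 ∧ Complete G A1 B2 ∧ Complete G A1 B3 ∧
    Anticomplete G A1 B0 ∧ Anticomplete G A1 C1 ∧ Anticomplete G A1 C2 ∧
    Anticomplete G A1 C3) ∧
  (Anticomplete G B0 B1 ∧ Anticomplete G B0 B2 ∧ Anticomplete G B0 B3 ∧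
    Anticomplete G B1 B2 ∧ Anticomplete G B1 B3 ∧ Anticomplete G B2 B3) ∧
  (Complete G C1 C2 ∧ Complete G C1 C3 ∧ Complete G C2 C3) ∧
  (Complete G C1 B0 ∧ Complete G C1 B1 ∧ Anticomplete G C1 B2 ∧ Anticomplete G C1 B3) ∧
  (Complete G C2 B2 ∧ Anticomplete G C2 B0 ∧ Anticomplete G C2 B1 ∧
    Anticomplete G C2 B3) ∧
  (Complete G C3 B3 ∧ Anticomplete G C3 B0 ∧ Anticomplete G C3 B1 ∧
    Anticomplete G C3 B2) ∧
  (Complete G F2 A0 ∧ Complete G F2 A1 ∧ Complete G F2 B0 ∧ Complete G F2 B1 ∧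
    Complete G F2 B3 ∧ Complete G F2 C1 ∧ Complete G F2 C3 ∧
    Anticomplete G F2 B2 ∧ Anticomplete G F2 C2) ∧
  (Complete G F3 A0 ∧ Complete G F3 A1 ∧ Complete G F3 B0 ∧ Complete G F3 B1 ∧
    Complete G F3 B2 ∧ Complete G F3 C1 ∧ Complete G F3 C2 ∧
    Anticomplete G F3 B3 ∧ Anticomplete G F3 C3) ∧
  (Complete G W A0 ∧ Complete G W A1 ∧ Complete G W B0 ∧ Complete G W B1 ∧
    Complete G W B2 ∧ Complete G W B3 ∧ Complete G W C1 ∧ Complete G W C2 ∧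
    Complete G W C3 ∧ Complete G W F2 ∧ Complete G W F3) ∧
  (Complete G Y C2 ∧ Complete G Y C3 ∧
    Anticomplete G Y A0 ∧ Anticomplete G Y A1 ∧ Anticomplete G Y B0 ∧
    Anticomplete G Y B1 ∧ Anticomplete G Y B2 ∧ Anticomplete G Y B3 ∧
    Anticomplete G Y C1) ∧
  (Anticomplete G Z A0 ∧ Anticomplete G Z A1 ∧ Anticomplete G Z B0 ∧
    Anticomplete G Z B1 ∧ Anticomplete G Z B2 ∧ Anticomplete G Z B3 ∧
    Anticomplete G Z C1 ∧ Anticomplete G Z C2 ∧ Anticomplete G Z C3 ∧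
    Anticomplete G Z Y) ∧
  -- Y can be ordered so that the closed neighborhoods form a chain
  ChainClosedNbhd G Y ∧
  -- Z is empty or can be partitioned into nonempty cliques, pairwise anticomplete,
  -- each ordered so that the closed neighborhoods form a chain
  (Z = ∅ ∨ OrderedCliquesPartition G Z)

/-- `G` is a tent. -/
def IsTent (G : SimpleGraph V) : Prop :=
  ∃ A0 A1 B0 B1 B2 B3 C1 C2 C3 F2 F3 W Y Z : Set V,
    IsTentPartition G A0 A1 B0 B1 B2 B3 C1 C2 C3 F2 F3 W Y Z

/-- Equality or adjacency: membership in the closed neighborhood. -/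
def CAdj {V : Type*} (G : SimpleGraph V) (x y : V) : Prop := x = y ∨ G.Adj x y

theorem CAdj.symm {G : SimpleGraph V} {x y : V} (h : CAdj G x y) : CAdj G y x :=
  h.imp Eq.symm SimpleGraph.Adj.symm

theorem CAdj.refl (G : SimpleGraph V) (x : V) : CAdj G x x := Or.inl rfl

theorem cAdj_comm {G : SimpleGraph V} {x y : V} : CAdj G x y ↔ CAdj G y x :=
  ⟨CAdj.symm, CAdj.symm⟩

instance {V : Type*} (G : SimpleGraph V) [DecidableEq V] [DecidableRel G.Adj] :
    DecidableRel (CAdj G) := fun x y => inferInstanceAs (Decidable (x = y ∨ G.Adj x y))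

instance : DecidableRel twoP3.Adj := by unfold twoP3; infer_instance
instance : DecidableRel T0.Adj := by unfold T0; infer_instance
instance : DecidableRel T1.Adj := by unfold T1; infer_instance

/-- `p` preserves and reflects closed adjacency. It need not be injective, so that both
induced copies of twin-free graphs and thickenings are maps of this kind. -/
def IsClosedEmb {W V : Type*} (H : SimpleGraph W) (G : SimpleGraph V) (p : W → V) : Prop :=
  ∀ i j, CAdj G (p i) (p j) ↔ CAdj H i j

theorem IsClosedEmb.comp {U W V : Type*} {K : SimpleGraph U} {H : SimpleGraph W}
    {G : SimpleGraph V} {q : W → V} {p : U → W} (hq : IsClosedEmb H G q)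
    (hp : IsClosedEmb K H p) : IsClosedEmb K G (q ∘ p) :=
  fun i j => (hq _ _).trans (hp i j)

/-- No two distinct vertices have the same closed neighborhood. -/
def TwinFree {W : Type*} (H : SimpleGraph W) : Prop :=
  ∀ i j, (∀ k, CAdj H i k ↔ CAdj H j k) → i = j

theorem containsInduced_iff {W : Type*} {G : SimpleGraph V} {H : SimpleGraph W}
    (hH : TwinFree H) : ContainsInduced G H ↔ ∃ p, IsClosedEmb H G p := by
  constructor
  · rintro ⟨s, ⟨e⟩⟩
    refine ⟨fun i => (e i : V), fun i j => or_congr ?_ e.map_adj_iff⟩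
    rw [Subtype.coe_inj, e.injective.eq_iff]
  · rintro ⟨p, hp⟩
    have hinj : Function.Injective p := fun i j hij =>
      hH i j fun k => by rw [← hp, ← hp, hij]
    refine ⟨Set.range p, ⟨⟨Equiv.ofInjective p hinj, fun {i j} => ?_⟩⟩⟩
    have hij := hp i j
    simp only [CAdj, hinj.eq_iff] at hij
    change G.Adj (p i) (p j) ↔ H.Adj i j
    by_cases h : i = j
    · simp [h]
    · simpa [h] using hij

theorem isThickening_iff {W : Type*} {G : SimpleGraph V} {H : SimpleGraph W} :
    IsThickening G H ↔ ∃ φ : V → W, φ.Surjective ∧ IsClosedEmb G H φ := by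
  constructor
  · rintro ⟨X, hne, hdisj, hU, hcl, hX⟩
    have hmem : ∀ v, ∃ i, v ∈ X i := fun v => Set.mem_iUnion.1 (hU ▸ Set.mem_univ v)
    choose φ hφ using hmem
    have huniq : ∀ v i, v ∈ X i → φ v = i := fun v i hi => by
      by_contra h
      exact Set.disjoint_left.1 (hdisj _ _ h) (hφ v) hi
    refine ⟨φ, fun i => (hne i).imp fun v hv => huniq v i hv, fun v w => ?_⟩
    by_cases h : φ v = φ w
    · have hvw : v = w ∨ G.Adj v w :=
        or_iff_not_imp_left.2 fun hne => hcl _ (hφ v) (h ▸ hφ w) hne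
      exact iff_of_true (Or.inl h) hvw
    · have hne : v ≠ w := fun e => h (e ▸ rfl)
      simp only [CAdj, h, hne, false_or]
      exact ⟨fun ha => (hX _ _ h).1 ha _ (hφ v) _ (hφ w),
        fun ha => by_contra fun hn => (hX _ _ h).2 hn _ (hφ v) _ (hφ w) ha⟩
  · rintro ⟨φ, hs, hφ⟩
    refine ⟨fun i => φ ⁻¹' {i}, hs, fun i j h => ?_, ?_, fun i v hv w hw h => ?_,
      fun i j h => ⟨?_, ?_⟩⟩
    · exact (Set.disjoint_singleton.2 h).preimage φ
    · ext v; simp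
    · exact ((hφ v w).1 (Or.inl (hv.trans hw.symm))).resolve_left h
    · rintro ha v rfl w rfl
      exact ((hφ v w).1 (Or.inr ha)).resolve_left fun e => h (congrArg φ e)
    · rintro hn v rfl w rfl ha
      exact ((hφ v w).2 (Or.inr ha)).elim h hn

theorem twinFree_twoP3 : TwinFree twoP3 := by unfold TwinFree; decide +kernel
theorem twinFree_cycleGraph_four : TwinFree (cycleGraph 4) := by unfold TwinFree; decide +kernel
theorem twinFree_cycleGraph_six : TwinFree (cycleGraph 6) := by unfold TwinFree; decide +kernel
theorem twinFree_cycleGraph_seven : TwinFree (cycleGraph 7) := by unfold TwinFree; decide +kernel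
theorem twinFree_T0 : TwinFree T0 := by unfold TwinFree; decide +kernel

theorem exists_isClosedEmb_cycleGraph_four {G : SimpleGraph V} {a b c d : V}
    (hab : CAdj G a b) (hbc : CAdj G b c) (hcd : CAdj G c d) (hda : CAdj G d a)
    (hac : ¬ CAdj G a c) (hbd : ¬ CAdj G b d) :
    ∃ p, IsClosedEmb (cycleGraph 4) G p := by
  refine ⟨![a, b, c, d], fun i j => ?_⟩
  have hij : (CAdj (cycleGraph 4) i j ↔ j = i ∨ j = i + 1 ∨ i = j + 1) := by
    revert i j; decide +kernel
  rw [hij]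
  fin_cases i <;> fin_cases j <;>
    simp [CAdj.refl, hab, hab.symm, hbc, hbc.symm, hcd, hcd.symm, hda, hda.symm, hac, hbd,
      cAdj_comm (x := c) (y := a), cAdj_comm (x := d) (y := b)]

theorem exists_isClosedEmb_twoP3 {G : SimpleGraph V} {a b c d e f : V}
    (hab : CAdj G a b) (hbc : CAdj G b c) (hac : ¬ CAdj G a c)
    (hde : CAdj G d e) (hef : CAdj G e f) (hdf : ¬ CAdj G d f)
    (hanti : ∀ x ∈ [a, b, c], ∀ y ∈ [d, e, f], ¬ CAdj G x y) :
    ∃ p, IsClosedEmb twoP3 G p := by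
  have hanti' : ∀ x ∈ [a, b, c], ∀ y ∈ [d, e, f], ¬ CAdj G y x :=
    fun x hx y hy h => hanti x hx y hy h.symm
  simp only [List.mem_cons, List.not_mem_nil, or_false, forall_eq_or_imp, forall_eq]
    at hanti hanti'
  refine ⟨![a, b, c, d, e, f], fun i j => ?_⟩
  have hij : (CAdj twoP3 i j ↔ j = i ∨ (i, j) ∈ [((0 : Fin 6), (1 : Fin 6)), (1, 0), (1, 2),
      (2, 1), (3, 4), (4, 3), (4, 5), (5, 4)]) := by
    revert i j; decide +kernel
  rw [hij]
  fin_cases i <;> fin_cases j <;>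
    simp [CAdj.refl, hab, hab.symm, hbc, hbc.symm, hde, hde.symm, hef, hef.symm, hac, hdf,
      cAdj_comm (x := c) (y := a), cAdj_comm (x := f) (y := d), hanti, hanti']

theorem IsClosedEmb.update {U W : Type*} [DecidableEq U] {K : SimpleGraph U}
    {H : SimpleGraph W} {G : SimpleGraph V} {p : W → V} (hp : IsClosedEmb H G p) {q : U → W}
    {u : U} {v : V} (hq : ∀ i j, i ≠ u → j ≠ u → (CAdj H (q i) (q j) ↔ CAdj K i j))
    (hv : ∀ i, i ≠ u → (CAdj G (p (q i)) v ↔ CAdj K i u)) :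
    IsClosedEmb K G (Function.update (p ∘ q) u v) := by
  intro i j
  by_cases hi : i = u <;> by_cases hj : j = u
  · subst hi hj; simp [CAdj.refl]
  · subst hi; simpa [hj, cAdj_comm (x := v), cAdj_comm (x := i)] using hv j hj
  · subst hj; simpa [hi] using hv i hi
  · simpa [hi, hj] using (hp _ _).trans (hq i j hi hj)

/-- The possible sets of closed neighbors in a copy of `T0` of a vertex of a graph without
induced `2P_3`, `C_4` and `C_6`: the first nine are the closed neighborhoods in `T0`, and
`9`, `10`, `11`, `12`, `13` correspond to the parts `F_3`, `F_2`, `W`, `Y`, `Z` of a tent. -/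
def traces : Fin 14 → List (Fin 9) :=
  ![[0, 1, 2, 4, 5], [0, 1, 3, 4, 5], [0, 2, 6], [1, 3, 6], [0, 1, 4, 7], [0, 1, 5, 8],
    [2, 3, 6, 7, 8], [4, 6, 7, 8], [5, 6, 7, 8], [0, 1, 2, 3, 4, 6, 7], [0, 1, 2, 3, 5, 6, 8],
    [0, 1, 2, 3, 4, 5, 6, 7, 8], [7, 8], []]

/-- Copies of `C_4` minus the vertex `3` in `T0`; the value at `3` is irrelevant. -/
def cycleFourMinus : List (Fin 4 → Fin 9) :=
  [![0, 2, 6, 0], ![0, 4, 7, 0], ![1, 3, 6, 0], ![1, 5, 8, 0], ![2, 0, 5, 0], ![2, 6, 3, 0],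
   ![2, 6, 7, 0], ![3, 1, 4, 0], ![3, 6, 7, 0], ![4, 0, 5, 0], ![4, 1, 5, 0], ![4, 7, 6, 0],
   ![4, 7, 8, 0], ![5, 8, 6, 0]]

/-- Copies of `C_6` minus the vertex `5` in `T0`; the value at `5` is irrelevant. -/
def cycleSixMinus : List (Fin 6 → Fin 9) :=
  [![0, 1, 3, 6, 7, 0], ![0, 4, 7, 6, 3, 0], ![1, 0, 2, 6, 8, 0], ![1, 4, 7, 6, 2, 0],
   ![2, 0, 5, 8, 7, 0], ![3, 1, 4, 7, 8, 0], ![4, 1, 3, 6, 8, 0], ![5, 0, 2, 6, 7, 0]]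

/-- Copies of `2P_3` minus the end vertex `5` in `T0`; the value at `5` is irrelevant. -/
def twoP3MinusEnd : List (Fin 6 → Fin 9) :=
  [![1, 0, 2, 7, 8, 0], ![1, 0, 2, 8, 7, 0], ![2, 6, 7, 1, 5, 0], ![2, 6, 7, 5, 1, 0],
   ![2, 6, 8, 4, 1, 0], ![3, 6, 7, 5, 0, 0], ![3, 6, 8, 0, 4, 0], ![3, 6, 8, 4, 0, 0],
   ![4, 0, 5, 3, 6, 0], ![4, 0, 5, 6, 3, 0], ![4, 1, 5, 2, 6, 0], ![4, 1, 5, 6, 2, 0]]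

/-- Copies of `2P_3` minus the middle vertex `4` in `T0`; the value at `4` is irrelevant. -/
def twoP3MinusMiddle : List (Fin 6 → Fin 9) :=
  [![2, 0, 4, 3, 0, 8], ![2, 0, 5, 3, 0, 7], ![2, 6, 3, 4, 0, 5], ![3, 1, 4, 2, 0, 8],
   ![3, 1, 5, 2, 0, 7], ![5, 8, 7, 2, 0, 3]]

set_option synthInstance.maxSize 1000 in
theorem exists_trace (r : Fin 9 → Bool)
    (h4 : ∀ q ∈ cycleFourMinus, r (q 0) → r (q 2) → r (q 1))
    (h6 : ∀ q ∈ cycleSixMinus, r (q 0) → r (q 4) → r (q 1) ∨ r (q 2) ∨ r (q 3))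
    (he : ∀ q ∈ twoP3MinusEnd, r (q 4) → r (q 0) ∨ r (q 1) ∨ r (q 2) ∨ r (q 3))
    (hm : ∀ q ∈ twoP3MinusMiddle, r (q 3) → r (q 5) → r (q 0) ∨ r (q 1) ∨ r (q 2)) :
    ∃ k, ∀ i, r i ↔ i ∈ traces k := by
  rw [← List.forall_iff_forall_mem] at h4 h6 he hm
  obtain ⟨b0, b1, b2, b3, b4, b5, b6, b7, b8, rfl⟩ :
      ∃ b0 b1 b2 b3 b4 b5 b6 b7 b8, r = ![b0, b1, b2, b3, b4, b5, b6, b7, b8] :=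
    ⟨r 0, r 1, r 2, r 3, r 4, r 5, r 6, r 7, r 8, by ext i; fin_cases i <;> rfl⟩
  revert b0 b1 b2 b3 b4 b5 b6 b7 b8
  decide +kernel

/-- The closed neighbors of `v` in the copy `p` of `T0` are given by `traces k`. -/
def HasTrace (G : SimpleGraph V) (p : Fin 9 → V) (v : V) (k : Fin 14) : Prop :=
  ∀ i, CAdj G (p i) v ↔ i ∈ traces k

/-- The index of the closed neighborhood of a vertex of `T0` among the traces. -/
abbrev part (i : Fin 9) : Fin 14 := i.castAdd 5

theorem cAdj_T0_iff {i j : Fin 9} : CAdj T0 i j ↔ i ∈ traces (part j) := by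
  revert i j; decide +kernel

theorem eq_of_traces_agree {k l : Fin 14} (i : Fin 9)
    (h : ∀ j, j ≠ i → (j ∈ traces k ↔ j ∈ traces l)) : k = l := by
  revert k l i; decide +kernel

theorem HasTrace.unique {G : SimpleGraph V} {p : Fin 9 → V} {v : V} {k l : Fin 14}
    (hk : HasTrace G p v k) (hl : HasTrace G p v l) : k = l :=
  eq_of_traces_agree 0 fun j _ => (hk j).symm.trans (hl j)

section Trace

variable {G : SimpleGraph V} {p : Fin 9 → V}

theorem IsClosedEmb.exists_trace (hp : IsClosedEmb T0 G p)
    (h2P3 : ¬ ∃ q, IsClosedEmb twoP3 G q) (hC4 : ¬ ∃ q, IsClosedEmb (cycleGraph 4) G q)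
    (hC6 : ¬ ∃ q, IsClosedEmb (cycleGraph 6) G q) (v : V) :
    ∃ k, HasTrace G p v k := by
  classical
  have key := Paper2P3.exists_trace (fun i => decide (CAdj G (p i) v))
  simp only [decide_eq_true_eq] at key
  refine key (fun q hq h0 h2 => ?_) (fun q hq h0 h4 => ?_) (fun q hq h4 => ?_)
    (fun q hq h3 h5 => ?_)
  · by_contra! hn
    have hT : ∀ q ∈ cycleFourMinus, ∀ i j, i ≠ 3 → j ≠ 3 →
        (CAdj T0 (q i) (q j) ↔ CAdj (cycleGraph 4) i j) := by
      rw [← List.forall_iff_forall_mem]; decide +kernel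
    refine hC4 ⟨_, hp.update (v := v) (hT q hq) fun i hi => ?_⟩
    have hi' : CAdj (cycleGraph 4) i 3 ↔ i ∈ ([0, 2, 3] : List (Fin 4)) := by
      revert i; decide +kernel
    rw [hi']
    fin_cases i <;> first | exact absurd rfl hi | simp [h0, h2, hn]
  · by_contra! hn
    have hT : ∀ q ∈ cycleSixMinus, ∀ i j, i ≠ 5 → j ≠ 5 →
        (CAdj T0 (q i) (q j) ↔ CAdj (cycleGraph 6) i j) := by
      rw [← List.forall_iff_forall_mem]; decide +kernel
    refine hC6 ⟨_, hp.update (v := v) (hT q hq) fun i hi => ?_⟩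
    have hi' : CAdj (cycleGraph 6) i 5 ↔ i ∈ ([0, 4, 5] : List (Fin 6)) := by
      revert i; decide +kernel
    rw [hi']
    fin_cases i <;> first | exact absurd rfl hi | simp [h0, h4, hn]
  · by_contra! hn
    have hT : ∀ q ∈ twoP3MinusEnd, ∀ i j, i ≠ 5 → j ≠ 5 →
        (CAdj T0 (q i) (q j) ↔ CAdj twoP3 i j) := by
      rw [← List.forall_iff_forall_mem]; decide +kernel
    refine h2P3 ⟨_, hp.update (v := v) (hT q hq) fun i hi => ?_⟩
    have hi' : CAdj twoP3 i 5 ↔ i ∈ ([4, 5] : List (Fin 6)) := by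
      revert i; decide +kernel
    rw [hi']
    fin_cases i <;> first | exact absurd rfl hi | simp [h4, hn]
  · by_contra! hn
    have hT : ∀ q ∈ twoP3MinusMiddle, ∀ i j, i ≠ 4 → j ≠ 4 →
        (CAdj T0 (q i) (q j) ↔ CAdj twoP3 i j) := by
      rw [← List.forall_iff_forall_mem]; decide +kernel
    refine h2P3 ⟨_, hp.update (v := v) (hT q hq) fun i hi => ?_⟩
    have hi' : CAdj twoP3 i 4 ↔ i ∈ ([3, 4, 5] : List (Fin 6)) := by
      revert i; decide +kernel
    rw [hi']
    fin_cases i <;> first | exact absurd rfl hi | simp [h3, h5, hn]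

theorem IsClosedEmb.cAdj_iff (hp : IsClosedEmb T0 G p)
    (h2P3 : ¬ ∃ q, IsClosedEmb twoP3 G q) (hC4 : ¬ ∃ q, IsClosedEmb (cycleGraph 4) G q)
    (hC6 : ¬ ∃ q, IsClosedEmb (cycleGraph 6) G q) {v w : V} {i : Fin 9} {k : Fin 14}
    (hv : HasTrace G p v (part i)) (hw : HasTrace G p w k) :
    CAdj G v w ↔ i ∈ traces k := by
  have hp' := hp.update (q := id) (u := i) (v := v) (fun _ _ _ _ => Iff.rfl)
    fun j _ => (hv j).trans cAdj_T0_iff.symm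
  obtain ⟨l, hl⟩ := hp'.exists_trace h2P3 hC4 hC6 w
  obtain rfl : k = l := eq_of_traces_agree i fun j hj => by
    have hj' := hl j
    rw [Function.update_of_ne hj] at hj'
    exact (hw j).symm.trans hj'
  simpa using hl i

theorem cAdj_of_mem_traces (hp : IsClosedEmb T0 G p)
    (hC4 : ¬ ∃ q, IsClosedEmb (cycleGraph 4) G q) {v w : V} {k l : Fin 14}
    (hv : HasTrace G p v k) (hw : HasTrace G p w l) {i j : Fin 9} (hij : ¬ CAdj T0 i j)
    (hi : i ∈ traces k ∧ i ∈ traces l) (hj : j ∈ traces k ∧ j ∈ traces l) : CAdj G v w := by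
  by_contra h
  exact hC4 (exists_isClosedEmb_cycleGraph_four ((hv i).2 hi.1).symm ((hw i).2 hi.2)
    ((hw j).2 hj.2).symm ((hv j).2 hj.1) h (mt (hp i j).1 hij))

theorem not_cAdj_of_mem_traces (hp : IsClosedEmb T0 G p)
    (hC4 : ¬ ∃ q, IsClosedEmb (cycleGraph 4) G q) {v w : V} {k l : Fin 14}
    (hv : HasTrace G p v k) (hw : HasTrace G p w l) {i j : Fin 9} (hij : CAdj T0 i j)
    (hi : i ∈ traces l ∧ i ∉ traces k) (hj : j ∈ traces k ∧ j ∉ traces l) : ¬ CAdj G v w :=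
  fun h => hC4 (exists_isClosedEmb_cycleGraph_four h ((hw i).2 hi.1).symm ((hp i j).2 hij)
    ((hv j).2 hj.1) (fun h' => hi.2 ((hv i).1 h'.symm)) (fun h' => hj.2 ((hw j).1 h'.symm)))

end Trace

/-- In a finite `C_4`-free graph, a nonempty set `U` inducing a disjoint union of cliques, such
that the attachments of each clique outside `U` form a clique, contains a simplicial vertex. -/
theorem exists_isSimplicial [Finite V] {G : SimpleGraph V}
    (hC4 : ¬ ∃ q, IsClosedEmb (cycleGraph 4) G q) {U : Set V} (hU : U.Nonempty)
    (hin : ∀ x ∈ U, ∀ y ∈ U, ∀ z ∈ U, CAdj G x y → CAdj G y z → CAdj G x z)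
    (hout : ∀ u ∈ U, ∀ v ∈ U, ∀ x ∉ U, ∀ y ∉ U, CAdj G u v → CAdj G u x → CAdj G v y →
      CAdj G x y) : ∃ v, IsSimplicial G v := by
  obtain ⟨u, hu, hmin⟩ := (Set.toFinite U).exists_minimalFor (fun v => {x | CAdj G v x}) U hU
  have mixed : ∀ x ∈ U, ∀ y ∉ U, CAdj G u x → CAdj G u y → CAdj G x y := by
    intro x hx y hy hux huy
    by_contra hxy
    have hnot : ¬ {z | CAdj G x z} ⊆ {z | CAdj G u z} := fun hsub =>
      hxy (hmin hx hsub huy)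
    obtain ⟨f, hxf, huf⟩ := Set.not_subset.1 hnot
    have hfU : f ∉ U := fun hf => huf (hin u hu x hx f hf hux hxf)
    have hfy : CAdj G f y := hout x hx u hu f hfU y hy hux.symm hxf huy
    exact hC4 (exists_isClosedEmb_cycleGraph_four hux hxf hfy huy.symm huf hxy)
  refine ⟨u, fun x hx y hy hne => ?_⟩
  have hux : CAdj G u x := Or.inr hx
  have huy : CAdj G u y := Or.inr hy
  have hxy : CAdj G x y := by
    by_cases hxU : x ∈ U <;> by_cases hyU : y ∈ U
    · exact hin x hxU u hu y hyU hux.symm huy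
    · exact mixed x hxU y hyU hux huy
    · exact (mixed y hyU x hxU huy hux).symm
    · exact hout u hu u hu x hxU y hyU (CAdj.refl G u) hux huy
  exact hxy.resolve_left hne

/-- Closed adjacency between vertices with traces `k` and `l` when neither of them is of
type `12` or `13`. -/
def TraceAdj (k l : Fin 14) : Prop :=
  (∀ i, part i = k → i ∈ traces l) ∧ ∀ i, part i = l → i ∈ traces k

instance : DecidableRel TraceAdj := fun k l =>
  inferInstanceAs (Decidable ((∀ i, part i = k → i ∈ traces l) ∧ ∀ i, part i = l → i ∈ traces k))

theorem part_or_le (k : Fin 14) : (∃ i, k = part i) ∨ 9 ≤ k := by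
  revert k; decide +kernel

section Classes

variable {G : SimpleGraph V} {p : Fin 9 → V} {c : V → Fin 14}

theorem cAdj_of_mem_Icc (hp : IsClosedEmb T0 G p)
    (hC4 : ¬ ∃ q, IsClosedEmb (cycleGraph 4) G q) (hc : ∀ v, HasTrace G p v (c v)) {v w : V}
    (hv : c v ∈ Set.Icc 9 11) (hw : c w ∈ Set.Icc 9 11) : CAdj G v w := by
  have h : ∀ k : Fin 14, k ∈ Set.Icc 9 11 → 0 ∈ traces k ∧ 6 ∈ traces k := by decide +kernel
  exact cAdj_of_mem_traces hp hC4 (hc v) (hc w) (i := 0) (j := 6) (by decide +kernel)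
    ⟨(h _ hv).1, (h _ hw).1⟩ ⟨(h _ hv).2, (h _ hw).2⟩

theorem cAdj_iff_traceAdj (hp : IsClosedEmb T0 G p)
    (h2P3 : ¬ ∃ q, IsClosedEmb twoP3 G q) (hC4 : ¬ ∃ q, IsClosedEmb (cycleGraph 4) G q)
    (hC6 : ¬ ∃ q, IsClosedEmb (cycleGraph 6) G q) (hc : ∀ v, HasTrace G p v (c v)) {v w : V}
    (hv : c v ≤ 11) (hw : c w ≤ 11) : CAdj G v w ↔ TraceAdj (c v) (c w) := by
  have left : ∀ {v w : V} {i}, c v = part i → (CAdj G v w ↔ i ∈ traces (c w)) :=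
    fun {v w i} h => hp.cAdj_iff h2P3 hC4 hC6 (h ▸ hc v) (hc w)
  constructor
  · exact fun h => ⟨fun i hi => (left hi.symm).1 h, fun i hi => (left hi.symm).1 h.symm⟩
  · rintro ⟨h1, h2⟩
    obtain ⟨i, hi⟩ | hv' := part_or_le (c v)
    · exact (left hi).2 (h1 i hi.symm)
    obtain ⟨i, hi⟩ | hw' := part_or_le (c w)
    · exact ((left hi).2 (h2 i hi.symm)).symm
    exact cAdj_of_mem_Icc hp hC4 hc ⟨hv', hv⟩ ⟨hw', hw⟩

/-- The parts `F_2` and `F_3` are not both nonempty. -/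
theorem ne_ten_of_eq_nine (hp : IsClosedEmb T0 G p)
    (hC4 : ¬ ∃ q, IsClosedEmb (cycleGraph 4) G q) (hc : ∀ v, HasTrace G p v (c v)) {v w : V}
    (hv : c v = 9) : c w ≠ 10 := by
  intro hw
  refine not_cAdj_of_mem_traces hp hC4 (hv ▸ hc v) (hw ▸ hc w) (i := 8) (j := 7)
    (by decide +kernel) (by decide +kernel) (by decide +kernel) ?_
  refine cAdj_of_mem_Icc hp hC4 hc ?_ ?_
  · rw [hv]; decide +kernel
  · rw [hw]; decide +kernel

/-- A path on three vertices anticomplete to an induced `P_3` in a copy of `T0` closes up. -/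
theorem cAdj_of_anticomplete (hp : IsClosedEmb T0 G p)
    (h2P3 : ¬ ∃ q, IsClosedEmb twoP3 G q) {x y z : V} (hxy : CAdj G x y) (hyz : CAdj G y z)
    (h : ∀ i ∈ [(0 : Fin 9), 1, 3], ¬ CAdj G (p i) x ∧ ¬ CAdj G (p i) y ∧ ¬ CAdj G (p i) z) :
    CAdj G x z := by
  by_contra hxz
  refine h2P3 (exists_isClosedEmb_twoP3 ((hp 0 1).2 (by decide +kernel))
    ((hp 1 3).2 (by decide +kernel)) (mt (hp 0 3).1 (by decide +kernel)) hxy hyz hxz ?_)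
  simpa using h

/-- If the part `Y` is nonempty, then `F_2` and `F_3` are empty. -/
theorem nine_ten_ne_of_eq_twelve (hp : IsClosedEmb T0 G p)
    (h2P3 : ¬ ∃ q, IsClosedEmb twoP3 G q) (hC4 : ¬ ∃ q, IsClosedEmb (cycleGraph 4) G q)
    (hc : ∀ v, HasTrace G p v (c v)) {v w : V} (hv : c v = 12) : c w ≠ 9 ∧ c w ≠ 10 := by
  have hv' : HasTrace G p v 12 := hv ▸ hc v
  have main : ∀ k, c w = k → ∀ j a : Fin 9, CAdj T0 6 j → j ∈ traces 12 → j ∉ traces k →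
      CAdj T0 a j → a ∉ traces 12 → a ∉ traces k →
      (∀ i ∈ [(2 : Fin 9), 3], ¬ CAdj T0 i a ∧ ¬ CAdj T0 i j) →
      (∀ i ∈ [(2 : Fin 9), 3, 6], i ∈ traces k ∧ i ∉ traces 12) → False := by
    rintro k rfl j a h6j hj hj' haj ha ha' hanti hmem
    simp only [List.mem_cons, List.not_mem_nil, or_false, forall_eq_or_imp, forall_eq]
      at hanti hmem
    have hvw : ¬ CAdj G w v := fun h =>
      not_cAdj_of_mem_traces hp hC4 hv' (hc w) h6j hmem.2.2 ⟨hj, hj'⟩ h.symm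
    refine h2P3 (exists_isClosedEmb_twoP3 ((hc w 2).2 hmem.1.1) ((hc w 3).2 hmem.2.1.1).symm
      (mt (hp 2 3).1 (by decide +kernel)) ((hp a j).2 haj) ((hv' j).2 hj)
      (mt (hv' a).1 ha) ?_)
    simp [hp _ _, hv' _, hc w _, cAdj_comm (x := w) (y := p _), *]
  constructor <;> intro hw
  · exact main 9 hw 8 5 (by decide +kernel) (by decide +kernel) (by decide +kernel)
      (by decide +kernel) (by decide +kernel) (by decide +kernel) (by decide +kernel)
      (by decide +kernel)
  · exact main 10 hw 7 4 (by decide +kernel) (by decide +kernel) (by decide +kernel)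
      (by decide +kernel) (by decide +kernel) (by decide +kernel) (by decide +kernel)
      (by decide +kernel)

theorem cAdj_trans_of_twelve_le (hp : IsClosedEmb T0 G p)
    (h2P3 : ¬ ∃ q, IsClosedEmb twoP3 G q) (hc : ∀ v, HasTrace G p v (c v)) {x y z : V}
    (hx : 12 ≤ c x) (hy : 12 ≤ c y) (hz : 12 ≤ c z)
    (hxy : CAdj G x y) (hyz : CAdj G y z) : CAdj G x z := by
  have h : ∀ k : Fin 14, 12 ≤ k → ∀ i ∈ [(0 : Fin 9), 1, 3], i ∉ traces k := by decide +kernel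
  exact cAdj_of_anticomplete hp h2P3 hxy hyz fun i hi => ⟨mt (hc x i).1 (h _ hx i hi),
    mt (hc y i).1 (h _ hy i hi), mt (hc z i).1 (h _ hz i hi)⟩

/-- The part `Y` is a clique anticomplete to the part `Z`. -/
theorem eq_of_cAdj (hp : IsClosedEmb T0 G p)
    (h2P3 : ¬ ∃ q, IsClosedEmb twoP3 G q) (hc : ∀ v, HasTrace G p v (c v)) {x y : V}
    (hx : 12 ≤ c x) (hy : 12 ≤ c y) (hxy : CAdj G x y) : c x = c y := by
  have main : ∀ {x y : V}, c x = 12 → c y = 13 → CAdj G x y → False := fun {x y} hx hy hxy => by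
    have hx' : HasTrace G p x 12 := hx ▸ hc x
    have hy' : HasTrace G p y 13 := hy ▸ hc y
    have h7 : ∀ i ∈ [(0 : Fin 9), 1, 3], ¬ CAdj T0 i 7 ∧ i ∉ traces 12 ∧ i ∉ traces 13 := by
      decide +kernel
    have h := cAdj_of_anticomplete hp h2P3 ((hx' 7).2 (by decide +kernel)) hxy fun i hi =>
      ⟨mt (hp i 7).1 (h7 i hi).1, mt (hx' i).1 (h7 i hi).2.1, mt (hy' i).1 (h7 i hi).2.2⟩
    exact absurd ((hy' 7).1 h) (by decide +kernel)
  have h : ∀ k : Fin 14, 12 ≤ k → k = 12 ∨ k = 13 := by decide +kernel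
  obtain hx | hx := h _ hx <;> obtain hy | hy := h _ hy
  · rw [hx, hy]
  · exact (main hx hy hxy).elim
  · exact (main hy hx hxy.symm).elim
  · rw [hx, hy]

/-- If the graph has no simplicial vertices, then the parts `Y` and `Z` are empty. -/
theorem le_eleven [Finite V] (hp : IsClosedEmb T0 G p)
    (h2P3 : ¬ ∃ q, IsClosedEmb twoP3 G q) (hC4 : ¬ ∃ q, IsClosedEmb (cycleGraph 4) G q)
    (hC6 : ¬ ∃ q, IsClosedEmb (cycleGraph 6) G q) (hc : ∀ v, HasTrace G p v (c v))
    (hs : ∀ v, ¬ IsSimplicial G v) (v : V) : c v ≤ 11 := by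
  by_contra hv
  have hle : ∀ k : Fin 14, ¬ k ≤ 11 ↔ 12 ≤ k := by decide +kernel
  refine (exists_isSimplicial hC4 (U := {v | 12 ≤ c v}) ⟨v, (hle _).1 hv⟩
    (fun x hx y hy z hz => cAdj_trans_of_twelve_le hp h2P3 hc hx hy hz) ?_).elim hs
  intro u hu v hv x hx y hy huv hux hvy
  replace hx := of_not_not (mt (hle _).1 hx)
  replace hy := of_not_not (mt (hle _).1 hy)
  have key : ∀ u x, 12 ≤ c u → c x ≤ 11 → CAdj G u x →
      (∃ i, c x = part i ∧ i ∈ traces (c u)) ∨ c x = 11 ∨ (c u = 13 ∧ 9 ≤ c x) := by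
    intro u x hu hx hux
    obtain ⟨i, hi⟩ | hx' := part_or_le (c x)
    · exact Or.inl ⟨i, hi, (hp.cAdj_iff h2P3 hC4 hC6 (hi ▸ hc x) (hc u)).1 hux.symm⟩
    have h : ∀ k l : Fin 14, 12 ≤ k → l ≤ 11 → 9 ≤ l →
        l = 11 ∨ (k = 13 ∧ 9 ≤ l) ∨ (k = 12 ∧ (l = 9 ∨ l = 10)) := by decide +kernel
    obtain h | h | ⟨h1, h2⟩ := h _ _ hu hx hx'
    · exact Or.inr (Or.inl h)
    · exact Or.inr (Or.inr h)
    · have := nine_ten_ne_of_eq_twelve hp h2P3 hC4 hc (w := x) h1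
      tauto
  have hu' := key u x hu hx hux
  have hv' := key v y hv hy hvy
  rw [← eq_of_cAdj hp h2P3 hc hu hv huv] at hv'
  refine (cAdj_iff_traceAdj hp h2P3 hC4 hC6 hc hx hy).2 ?_
  have final : ∀ k l m : Fin 14, 12 ≤ k → l ≤ 11 → m ≤ 11 →
      ((∃ i, l = part i ∧ i ∈ traces k) ∨ l = 11 ∨ (k = 13 ∧ 9 ≤ l)) →
      ((∃ i, m = part i ∧ i ∈ traces k) ∨ m = 11 ∨ (k = 13 ∧ 9 ≤ m)) → TraceAdj l m := by
    decide +kernel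
  exact final _ _ _ hu hx hy hu' hv'

end Classes

theorem cAdj_induce {G : SimpleGraph V} {S : Set V} {x y : S} :
    CAdj (G.induce S) x y ↔ CAdj G x y := by
  simp [CAdj, Subtype.ext_iff]

theorem exists_isThickening [Finite V] {G : SimpleGraph V} {p : Fin 9 → V}
    (hp : IsClosedEmb T0 G p) (h2P3 : ¬ ∃ q, IsClosedEmb twoP3 G q)
    (hC4 : ¬ ∃ q, IsClosedEmb (cycleGraph 4) G q) (hC6 : ¬ ∃ q, IsClosedEmb (cycleGraph 6) G q)
    (hs : ∀ v, ¬ IsSimplicial G v) :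
    ∃ S : Set V, (IsThickening (G.induce S) T0 ∨ IsThickening (G.induce S) T1) ∧
      G.IsClique Sᶜ ∧ Complete G Sᶜ S := by
  choose c hc using fun v => hp.exists_trace h2P3 hC4 hC6 v
  have hle := le_eleven hp h2P3 hC4 hC6 hc hs
  have hadj : ∀ v w, CAdj G v w ↔ TraceAdj (c v) (c w) := fun v w =>
    cAdj_iff_traceAdj hp h2P3 hC4 hC6 hc (hle v) (hle w)
  have hcp : ∀ i, c (p i) = part i := fun i =>
    (hc (p i)).unique fun j => (hp j i).trans cAdj_T0_iff
  have huniv : ∀ v w, c v = 11 → CAdj G v w := fun v w hv => by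
    have h : ∀ k : Fin 14, k ≤ 11 → TraceAdj 11 k := by decide +kernel
    exact (hadj v w).2 (hv ▸ h _ (hle w))
  have thick : ∀ {n : ℕ} (H : SimpleGraph (Fin n)) (σ : Fin 14 → Fin n)
      (L : List (Fin 14)), (∀ v, c v ≠ 11 → c v ∈ L) →
      (∀ k ∈ L, ∀ l ∈ L, TraceAdj k l ↔ CAdj H (σ k) (σ l)) →
      (∀ i : Fin n, ∃ v, c v ≠ 11 ∧ σ (c v) = i) →
      IsThickening (G.induce {v | c v ≠ 11}) H := by
    intro n H σ L hL hσ hsurj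
    refine isThickening_iff.2 ⟨fun v => σ (c v), fun i => ?_, fun v w => ?_⟩
    · obtain ⟨v, hv, hi⟩ := hsurj i
      exact ⟨⟨v, hv⟩, hi⟩
    · rw [cAdj_induce, hadj, hσ _ (hL _ v.2) _ (hL _ w.2)]
  refine ⟨{v | c v ≠ 11}, ?_, fun v hv w _ hne => ?_, fun v hv w hw => ?_⟩
  · have hne : ∀ i, part i ≠ 11 := by decide +kernel
    by_cases h9 : ∃ v, c v = 9
    · obtain ⟨v, hv⟩ := h9
      refine Or.inr (thick T1 (fun k => Fin.ofNat 10 k) [0, 1, 2, 3, 4, 5, 6, 7, 8, 9]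
        (fun w hw => ?_) (by decide +kernel) fun i => ?_)
      · have h : ∀ k : Fin 14, k ≤ 11 → k ≠ 11 → k ≠ 10 →
            k ∈ [(0 : Fin 14), 1, 2, 3, 4, 5, 6, 7, 8, 9] := by decide +kernel
        exact h _ (hle w) hw (ne_ten_of_eq_nine hp hC4 hc hv)
      · have h : ∀ i : Fin 10, i = Fin.ofNat 10 (9 : Fin 14) ∨
            ∃ j, Fin.ofNat 10 (part j) = i := by decide +kernel
        obtain rfl | ⟨j, rfl⟩ := h i
        · exact ⟨v, by rw [hv]; decide +kernel, by rw [hv]⟩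
        · exact ⟨p j, hcp j ▸ hne j, by rw [hcp]⟩
    by_cases h10 : ∃ v, c v = 10
    · obtain ⟨v, hv⟩ := h10
      refine Or.inr (thick T1 ![0, 1, 2, 3, 5, 4, 6, 8, 7, 0, 9, 0, 0, 0]
        [0, 1, 2, 3, 4, 5, 6, 7, 8, 10] (fun w hw => ?_) (by decide +kernel) fun i => ?_)
      · have h : ∀ k : Fin 14, k ≤ 11 → k ≠ 11 → k ≠ 9 →
            k ∈ [(0 : Fin 14), 1, 2, 3, 4, 5, 6, 7, 8, 10] := by decide +kernel
        exact h _ (hle w) hw fun h => h9 ⟨w, h⟩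
      · have h : ∀ i : Fin 10, i = 9 ∨ ∃ j, (![0, 1, 2, 3, 5, 4, 6, 8, 7, 0, 9, 0, 0, 0] :
            Fin 14 → Fin 10) (part j) = i := by decide +kernel
        obtain rfl | ⟨j, rfl⟩ := h i
        · exact ⟨v, by rw [hv]; decide +kernel, by rw [hv]; rfl⟩
        · exact ⟨p j, hcp j ▸ hne j, by rw [hcp]⟩
    · refine Or.inl (thick T0 (fun k => Fin.ofNat 9 k) [0, 1, 2, 3, 4, 5, 6, 7, 8]
        (fun w hw => ?_) (by decide +kernel) fun i => ?_)
      · have h : ∀ k : Fin 14, k ≤ 11 → k ≠ 11 → k ≠ 9 → k ≠ 10 →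
            k ∈ [(0 : Fin 14), 1, 2, 3, 4, 5, 6, 7, 8] := by decide +kernel
        exact h _ (hle w) hw (fun h => h9 ⟨w, h⟩) fun h => h10 ⟨w, h⟩
      · have h : ∀ i : Fin 9, Fin.ofNat 9 (part i) = i := by decide +kernel
        exact ⟨p i, hcp i ▸ hne i, by rw [hcp, h]⟩
  · exact (huniv v w (of_not_not hv)).resolve_left hne
  · exact (huniv v w (of_not_not hv)).resolve_left fun e => hv (e ▸ hw)

/-- The closed neighborhoods in `T1`. -/
def nbrs : Fin 10 → List (Fin 10) :=
  ![[0, 1, 2, 4, 5, 9], [0, 1, 3, 4, 5, 9], [0, 2, 6, 9], [1, 3, 6, 9], [0, 1, 4, 7, 9],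
    [0, 1, 5, 8], [2, 3, 6, 7, 8, 9], [4, 6, 7, 8, 9], [5, 6, 7, 8], [0, 1, 2, 3, 4, 6, 7, 9]]

theorem cAdj_T1_iff {i j : Fin 10} : CAdj T1 i j ↔ j ∈ nbrs i := by
  revert i j; decide +kernel

theorem not_isClosedEmb_cycleGraph_four (p : Fin 4 → Fin 10) :
    ¬ IsClosedEmb (cycleGraph 4) T1 p := by
  intro hp
  have h : ∀ a, ∀ b ∈ nbrs a, ∀ c ∈ nbrs b, c ∉ nbrs a → ∀ d ∈ nbrs a, d ∈ nbrs c →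
      d ∈ nbrs b := by decide +kernel
  refine absurd (h (p 0) (p 1) ?_ (p 2) ?_ ?_ (p 3) ?_ ?_) ?_ <;>
    rw [← cAdj_T1_iff, hp] <;> decide +kernel

set_option synthInstance.maxSize 1000 in
theorem not_isClosedEmb_cycleGraph_six (p : Fin 6 → Fin 10) :
    ¬ IsClosedEmb (cycleGraph 6) T1 p := by
  intro hp
  have h : ∀ a, ∀ b ∈ nbrs a, ∀ c ∈ nbrs b, c ∉ nbrs a → ∀ d ∈ nbrs c, d ∉ nbrs a →
      d ∉ nbrs b → ∀ e ∈ nbrs d, e ∉ nbrs a → e ∉ nbrs b → e ∉ nbrs c →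
      ∀ f ∈ nbrs e, f ∈ nbrs a → f ∈ nbrs b ∨ f ∈ nbrs c ∨ f ∈ nbrs d := by decide +kernel
  have := h (p 0) (p 1) ?_ (p 2) ?_ ?_ (p 3) ?_ ?_ ?_ (p 4) ?_ ?_ ?_ ?_ (p 5) ?_ ?_
  · simp only [← cAdj_T1_iff, hp _ _] at this
    revert this; decide +kernel
  all_goals rw [← cAdj_T1_iff, hp]; decide +kernel

set_option synthInstance.maxSize 1000 in
theorem not_isClosedEmb_cycleGraph_seven (p : Fin 7 → Fin 10) :
    ¬ IsClosedEmb (cycleGraph 7) T1 p := by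
  intro hp
  have h : ∀ a, ∀ b ∈ nbrs a, ∀ c ∈ nbrs b, c ∉ nbrs a → ∀ d ∈ nbrs c, d ∉ nbrs a →
      d ∉ nbrs b → ∀ e ∈ nbrs d, e ∉ nbrs a → e ∉ nbrs b → e ∉ nbrs c →
      ∀ f ∈ nbrs e, f ∉ nbrs a → f ∉ nbrs b → f ∉ nbrs c → f ∉ nbrs d →
      ∀ g ∈ nbrs f, g ∈ nbrs a → g ∈ nbrs b ∨ g ∈ nbrs c ∨ g ∈ nbrs d ∨ g ∈ nbrs e := by
    decide +kernel
  have := h (p 0) (p 1) ?_ (p 2) ?_ ?_ (p 3) ?_ ?_ ?_ (p 4) ?_ ?_ ?_ ?_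
    (p 5) ?_ ?_ ?_ ?_ ?_ (p 6) ?_ ?_
  · simp only [← cAdj_T1_iff, hp _ _] at this
    revert this; decide +kernel
  all_goals rw [← cAdj_T1_iff, hp]; decide +kernel

set_option synthInstance.maxSize 1000 in
theorem not_isClosedEmb_twoP3 (p : Fin 6 → Fin 10) : ¬ IsClosedEmb twoP3 T1 p := by
  intro hp
  have h : ∀ a, ∀ b ∈ nbrs a, ∀ c ∈ nbrs b, c ∉ nbrs a →
      ∀ d, d ∉ nbrs a → d ∉ nbrs b → d ∉ nbrs c →
      ∀ e ∈ nbrs d, e ∉ nbrs a → e ∉ nbrs b → e ∉ nbrs c →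
      ∀ f ∈ nbrs e, f ∉ nbrs a → f ∉ nbrs b → f ∉ nbrs c → f ∈ nbrs d := by
    decide +kernel
  refine absurd (h (p 0) (p 1) ?_ (p 2) ?_ ?_ (p 3) ?_ ?_ ?_ (p 4) ?_ ?_ ?_ ?_
    (p 5) ?_ ?_ ?_ ?_) ?_ <;> rw [← cAdj_T1_iff, hp] <;> decide +kernel

section Universal

variable {W : Type*} {G : SimpleGraph V} {S : Set V} {H : SimpleGraph W} {φ : S → W}

theorem cAdj_of_notMem (hcl : G.IsClique Sᶜ) (hco : Complete G Sᶜ S) {u : V} (hu : u ∉ S)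
    (v : V) : CAdj G u v := by
  by_cases hv : v ∈ S
  · exact Or.inr (hco u hu v hv)
  · exact or_iff_not_imp_left.2 fun h => hcl hu hv h

/-- Adding universal vertices creates no induced copy of a graph without universal vertices. -/
theorem exists_isClosedEmb_of_induce (hcl : G.IsClique Sᶜ) (hco : Complete G Sᶜ S)
    (hφ : IsClosedEmb (G.induce S) H φ) {U : Type*} {K : SimpleGraph U}
    (hK : ∀ i, ∃ j, ¬ CAdj K i j) {q : U → V} (hq : IsClosedEmb K G q) :
    ∃ r, IsClosedEmb K H r := by
  have hqS : ∀ i, q i ∈ S := fun i => by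
    by_contra h
    obtain ⟨j, hj⟩ := hK i
    exact hj ((hq i j).1 (cAdj_of_notMem hcl hco h _))
  exact ⟨_, hφ.comp (p := fun i => ⟨q i, hqS i⟩) fun i j => cAdj_induce.trans (hq i j)⟩

theorem not_isSimplicial_of_induce (hco : Complete G Sᶜ S)
    (hsurj : φ.Surjective) (hφ : IsClosedEmb (G.induce S) H φ) [Nonempty W]
    (hH : ∀ i, ∃ j k, H.Adj i j ∧ H.Adj i k ∧ ¬ CAdj H j k) (v : V) : ¬ IsSimplicial G v := by
  intro hv
  have main : ∀ j k, ¬ CAdj H j k → (∀ w : S, φ w = j ∨ φ w = k → G.Adj v w) → False := by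
    intro j k hjk hw
    obtain ⟨x, rfl⟩ := hsurj j
    obtain ⟨y, rfl⟩ := hsurj k
    rw [hφ, cAdj_induce] at hjk
    exact hjk (or_iff_not_imp_left.2 (hv (hw x (Or.inl rfl)) (hw y (Or.inr rfl))))
  by_cases hvS : v ∈ S
  · obtain ⟨j, k, hj, hk, hjk⟩ := hH (φ ⟨v, hvS⟩)
    refine main j k hjk fun w hw => ?_
    have hvw : H.Adj (φ ⟨v, hvS⟩) (φ w) := by obtain h | h := hw <;> rwa [h]
    refine (cAdj_induce.1 ((hφ ⟨v, hvS⟩ w).1 (Or.inr hvw))).resolve_left fun h => ?_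
    obtain rfl : ⟨v, hvS⟩ = w := Subtype.ext h
    exact hvw.ne rfl
  · obtain ⟨j, k, -, -, hjk⟩ := hH (Classical.arbitrary W)
    exact main j k hjk fun w _ => hco v hvS w w.2

theorem of_isThickening (hcl : G.IsClique Sᶜ) (hco : Complete G Sᶜ S) [Nonempty W]
    {e : Fin 9 → W} (he : IsClosedEmb T0 H e) {f : W → Fin 10} (hf : IsClosedEmb H T1 f)
    (hH : ∀ i, ∃ j k, H.Adj i j ∧ H.Adj i k ∧ ¬ CAdj H j k)
    (hS : IsThickening (G.induce S) H) :
    HFree G twoP3 ∧ HFree G (cycleGraph 4) ∧ HFree G (cycleGraph 6) ∧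
      HFree G (cycleGraph 7) ∧ ContainsInduced G T0 ∧ ∀ v : V, ¬ IsSimplicial G v := by
  obtain ⟨φ, hsurj, hφ⟩ := isThickening_iff.1 hS
  obtain ⟨g, hg⟩ := hsurj.hasRightInverse
  have free : ∀ {n : ℕ} {K : SimpleGraph (Fin n)}, TwinFree K → (∀ i, ∃ j, ¬ CAdj K i j) →
      (∀ p, ¬ IsClosedEmb K T1 p) → HFree G K := fun hK hK' hp h => by
    obtain ⟨q, hq⟩ := (containsInduced_iff hK).1 h
    obtain ⟨r, hr⟩ := exists_isClosedEmb_of_induce hcl hco hφ hK' hq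
    exact hp _ (hf.comp hr)
  refine ⟨free twinFree_twoP3 (by decide +kernel) not_isClosedEmb_twoP3,
    free twinFree_cycleGraph_four (by decide +kernel) not_isClosedEmb_cycleGraph_four,
    free twinFree_cycleGraph_six (by decide +kernel) not_isClosedEmb_cycleGraph_six,
    free twinFree_cycleGraph_seven (by decide +kernel) not_isClosedEmb_cycleGraph_seven,
    (containsInduced_iff twinFree_T0).2 ⟨fun i => g (e i), ?_⟩,
    not_isSimplicial_of_induce hco hsurj hφ hH⟩
  intro i j
  rw [← cAdj_induce, ← he i j, ← hφ, hg, hg]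

end Universal

/-- A graph is `(2P_3,C_4,C_6,C_7)`-free, contains an induced `T_0`, and contains no
simplicial vertices if and only if it can be obtained from a thickening of `T_0` or
of `T_1` by possibly adding universal vertices to it. -/
theorem statement11 {V : Type*} [Fintype V] (G : SimpleGraph V) :
    (HFree G twoP3 ∧ HFree G (cycleGraph 4) ∧ HFree G (cycleGraph 6) ∧
      HFree G (cycleGraph 7) ∧ ContainsInduced G T0 ∧
      (∀ v : V, ¬ IsSimplicial G v)) ↔
    (∃ S : Set V, (IsThickening (G.induce S) T0 ∨ IsThickening (G.induce S) T1) ∧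
      G.IsClique Sᶜ ∧ Complete G Sᶜ S) := by
  constructor
  · rintro ⟨h2P3, hC4, hC6, -, hT0, hs⟩
    obtain ⟨p, hp⟩ := (containsInduced_iff twinFree_T0).1 hT0
    exact exists_isThickening hp (mt (containsInduced_iff twinFree_twoP3).2 h2P3)
      (mt (containsInduced_iff twinFree_cycleGraph_four).2 hC4)
      (mt (containsInduced_iff twinFree_cycleGraph_six).2 hC6) hs
  · rintro ⟨S, hS | hS, hcl, hco⟩
    · exact of_isThickening hcl hco (e := id) (fun _ _ => Iff.rfl) (f := Fin.castSucc)
        (by unfold IsClosedEmb; decide +kernel) (by decide +kernel) hS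
    · exact of_isThickening hcl hco (e := Fin.castSucc)
        (by unfold IsClosedEmb; decide +kernel) (f := id) (fun _ _ => Iff.rfl)
        (by decide +kernel) hS

end Paper2P3
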